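/- arXiv:2504.02913 — 11 statements merged into one kernel-verified Lean document; each statement's English description precedes it below -/
import Mathlib

section
/- Let a ∈ (-1,1), q > 0 and r > 0 be real numbers. Then there exists a unique positive real number p satisfying the scalar discrete algebraic Riccati equation p = a²p − (ap)²/(p + r) + q (equivalently, p = a²·p·r/(p + r) + q). -/
/-- For `a ∈ (-1,1)`, `q > 0`, `r > 0`, the scalar discrete algebraic Riccati equation
`p = a²p − (ap)²/(p + r) + q` has a unique positive solution. -/
theorem dare_existsUnique_pos_solution
    (a q r : ℝ) (ha : a ∈ Set.Ioo (-1 : ℝ) 1) (hq : 0 < q) (hr : 0 < r) :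
    ∃! p : ℝ, 0 < p ∧ p = a ^ 2 * p - (a * p) ^ 2 / (p + r) + q := by
  have key : ∀ p : ℝ, 0 < p → (p = a ^ 2 * p - (a * p) ^ 2 / (p + r) + q ↔
      p ^ 2 + (r - a ^ 2 * r - q) * p = q * r) := by
    intro p hp
    have h : p + r ≠ 0 := by positivity
    have e : (p - (a ^ 2 * p - (a * p) ^ 2 / (p + r) + q)) * (p + r) =
        p ^ 2 + (r - a ^ 2 * r - q) * p - q * r := by
      field_simp
      ring
    rw [← sub_eq_zero, ← sub_eq_zero (b := q * r), ← e]
    simp [h]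
  generalize r - a ^ 2 * r - q = b at key
  have hqr : 0 < q * r := by positivity
  have hs : Real.sqrt (b ^ 2 + 4 * (q * r)) ^ 2 = b ^ 2 + 4 * (q * r) :=
    Real.sq_sqrt (by positivity)
  have hb : b < Real.sqrt (b ^ 2 + 4 * (q * r)) :=
    Real.lt_sqrt_of_sq_lt (by linarith)
  generalize Real.sqrt (b ^ 2 + 4 * (q * r)) = s at hs hb
  have hp : 0 < (s - b) / 2 := by linarith
  have h1 : ((s - b) / 2) ^ 2 + b * ((s - b) / 2) = q * r := by linarith
  refine ⟨(s - b) / 2, ⟨hp, (key _ hp).2 h1⟩, ?_⟩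
  rintro y ⟨hy, hy'⟩
  have h2 := (key y hy).1 hy'
  generalize (s - b) / 2 = p at hp h1
  have h3 : (y - p) * (y + p + b) = 0 := by linarith
  rcases mul_eq_zero.1 h3 with h | h
  · linarith
  · have hyp := mul_pos hy hp
    have h4 : b = -y - p := by linarith
    subst h4
    nlinarith
end

section
/- Let a ∈ (-1,1) and q > 0 be real numbers, let (r_k) be a sequence of positive real numbers with r_k → r̄ > 0, and let (p_k) be the sequence defined by an arbitrary initial value p_1 > 0 and the time-varying Riccati iteration p_{k+1} = a²p_k − (a p_k)²/(p_k + r_k) + q. Then p_k converges, as k → ∞, to the unique positive solution p_∞ of the scalar discrete algebraic Riccati equation p = a²p − (ap)²/(p + r̄) + q; moreover, setting α_∞ = p_∞/(p_∞ + r̄), one has (1 − α_∞)·a ∈ (−1, 1). -/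
theorem aux_contract (c : ℝ) (hc0 : 0 ≤ c) (hc1 : c < 1) (e d : ℕ → ℝ) (he : ∀ k, 0 ≤ e k)
    (hd : Filter.Tendsto d Filter.atTop (nhds 0))
    (h : ∀ k ≥ 1, e (k + 1) ≤ c * e k + d k) :
    Filter.Tendsto e Filter.atTop (nhds 0) := by
  rw [Metric.tendsto_atTop]
  intro ε hε
  have h1 : 0 < (1 - c) * (ε / 2) := by
    apply mul_pos <;> linarith
  obtain ⟨N, hN⟩ := (hd.eventually (gt_mem_nhds h1)).exists_forall_of_atTop
  have key : ∀ m, e (N + 1 + m) ≤ c ^ m * e (N + 1) + ε / 2 := by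
    intro m
    induction m with
    | zero => simp; linarith
    | succ m ih =>
      have h2 := h (N + 1 + m) (by omega)
      have h3 := hN (N + 1 + m) (by omega)
      have h4 := mul_le_mul_of_nonneg_left ih hc0
      rw [← add_assoc, pow_succ]
      nlinarith
  have hlim : Filter.Tendsto (fun m => c ^ m * e (N + 1)) Filter.atTop (nhds 0) := by
    simpa using (tendsto_pow_atTop_nhds_zero_of_lt_one hc0 hc1).mul_const (e (N + 1))
  obtain ⟨M, hM⟩ := (hlim.eventually (gt_mem_nhds (half_pos hε))).exists_forall_of_atTop
  refine ⟨N + 1 + M, fun n hn => ?_⟩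
  obtain ⟨m, rfl⟩ := Nat.exists_eq_add_of_le (show N + 1 ≤ n by omega)
  have h5 := key m
  have h6 := hM m (by omega)
  rw [Real.dist_eq, sub_zero, abs_of_nonneg (he _)]
  linarith

theorem aux_frac (x y z : ℝ) (hx : 0 < x) (hy : 0 < y) (hz : 0 < z) :
    |x * z / (x + z) - y * z / (y + z)| ≤ |x - y| := by
  have h : x * z / (x + z) - y * z / (y + z) = (x - y) * (z ^ 2 / ((x + z) * (y + z))) := by
    field_simp
    ring
  rw [h, abs_mul, abs_of_nonneg (show 0 ≤ z ^ 2 / ((x + z) * (y + z)) by positivity)]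
  apply mul_le_of_le_one_right (abs_nonneg _)
  rw [div_le_one (by positivity)]
  nlinarith [mul_pos hx hy, mul_pos hx hz, mul_pos hy hz]

theorem aux_form (a q x z : ℝ) (hx : 0 < x) (hz : 0 < z) :
    a ^ 2 * x - (a * x) ^ 2 / (x + z) + q = a ^ 2 * (x * z / (x + z)) + q := by
  field_simp
  ring

/-- Lemma 1: for `a ∈ (-1,1)`, `q > 0`, a positive noise-variance sequence `r_k → r̄ > 0`,
the time-varying Riccati iteration `p_{k+1} = a²p_k − (a p_k)²/(p_k + r_k) + q`,
started from any `p_1 > 0`, converges to the unique positive solution `p_∞` of the DARE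
`p = a²p − (ap)²/(p + r̄) + q`; moreover `(1 − α_∞)·a ∈ (−1,1)` where
`α_∞ = p_∞/(p_∞ + r̄)`. -/
theorem timeVarying_riccati_tendsto_dare_solution
    (a q : ℝ) (ha : a ∈ Set.Ioo (-1 : ℝ) 1) (hq : 0 < q)
    (r : ℕ → ℝ) (hrpos : ∀ k, 0 < r k) (rbar : ℝ) (hrbar : 0 < rbar)
    (hrlim : Filter.Tendsto r Filter.atTop (nhds rbar))
    (p : ℕ → ℝ) (hp1 : 0 < p 1)
    (hrec : ∀ k ≥ 1, p (k + 1) = a ^ 2 * p k - (a * p k) ^ 2 / (p k + r k) + q)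
    (pinf : ℝ) (hpos : 0 < pinf)
    (hfix : pinf = a ^ 2 * pinf - (a * pinf) ^ 2 / (pinf + rbar) + q) :
    Filter.Tendsto p Filter.atTop (nhds pinf) ∧
      (1 - pinf / (pinf + rbar)) * a ∈ Set.Ioo (-1 : ℝ) 1 := by
  have ha2 : a ^ 2 < 1 := by
    obtain ⟨h1, h2⟩ := ha
    nlinarith
  constructor
  · have hp : ∀ k ≥ 1, 0 < p k := by
      intro k hk
      induction k, hk using Nat.le_induction with
      | base => exact hp1
      | succ k hk ih =>
        rw [hrec k hk, aux_form _ _ _ _ ih (hrpos k)]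
        have := hrpos k
        positivity
    have hR : Filter.Tendsto (fun k => |r k - rbar|) Filter.atTop (nhds 0) := by
      have := (hrlim.sub_const rbar).abs
      simpa using this
    have hE := aux_contract (a ^ 2) (sq_nonneg a) ha2 (fun k => |p k - pinf|)
      (fun k => |r k - rbar|) (fun k => abs_nonneg _) hR (by
        intro k hk
        have hr := hrpos k
        have hpk := hp k hk
        rw [aux_form _ _ _ _ hpos hrbar] at hfix
        have e : p (k + 1) - pinf = a ^ 2 * ((p k * r k / (p k + r k) - pinf * r k / (pinf + r k))
            + (r k * pinf / (r k + pinf) - rbar * pinf / (rbar + pinf))) := by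
          rw [hrec k hk, aux_form _ _ _ _ hpk hr, mul_comm (r k) pinf, mul_comm rbar pinf,
            add_comm (r k) pinf, add_comm rbar pinf]
          linear_combination -hfix
        have h1 := aux_frac (p k) pinf (r k) hpk hpos hr
        have h2 := aux_frac (r k) rbar pinf hr hrbar hpos
        have h3 := abs_add_le (p k * r k / (p k + r k) - pinf * r k / (pinf + r k))
          (r k * pinf / (r k + pinf) - rbar * pinf / (rbar + pinf))
        have h4 := mul_le_mul_of_nonneg_left (h3.trans (add_le_add h1 h2)) (sq_nonneg a)
        have h5 : a ^ 2 * |r k - rbar| ≤ |r k - rbar| :=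
          mul_le_of_le_one_left (abs_nonneg _) ha2.le
        show |p (k + 1) - pinf| ≤ a ^ 2 * |p k - pinf| + |r k - rbar|
        rw [e, abs_mul, abs_of_nonneg (sq_nonneg a)]
        linarith)
    rw [tendsto_iff_dist_tendsto_zero]
    simpa [Real.dist_eq] using hE
  · have h : 1 - pinf / (pinf + rbar) = rbar / (pinf + rbar) := by
      field_simp
      ring
    have h0 : 0 < rbar / (pinf + rbar) := by positivity
    have h1 : rbar / (pinf + rbar) < 1 := by
      rw [div_lt_one (by positivity)]
      linarith
    rw [h]
    obtain ⟨h2, h3⟩ := ha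
    constructor <;> nlinarith
end

section
/- Let a ∈ (-1,1) and q > 0. For r > 0 let P(r) denote the unique positive solution of the scalar discrete algebraic Riccati equation p = a²p − (ap)²/(p + r) + q. If a ≠ 0 and 0 < r₁ < r₂, then P(r₁) < P(r₂); that is, the positive DARE solution is strictly increasing in the noise variance r. -/
/-- For `a ∈ (-1,1)` with `a ≠ 0` and `q > 0`, the unique positive solution of the
scalar DARE `p = a²p − (ap)²/(p + r) + q` is strictly increasing in the noise
variance `r`: if `0 < r₁ < r₂` and `p₁`, `p₂` are the positive DARE solutions
associated with `r₁`, `r₂`, then `p₁ < p₂`. -/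
theorem dare_solution_strictMono_in_r
    (a q : ℝ) (ha : a ∈ Set.Ioo (-1 : ℝ) 1) (ha0 : a ≠ 0) (hq : 0 < q)
    (r₁ r₂ : ℝ) (hr₁ : 0 < r₁) (hr₁₂ : r₁ < r₂)
    (p₁ p₂ : ℝ) (hp₁pos : 0 < p₁) (hp₂pos : 0 < p₂)
    (hp₁ : p₁ = a ^ 2 * p₁ - (a * p₁) ^ 2 / (p₁ + r₁) + q)
    (hp₂ : p₂ = a ^ 2 * p₂ - (a * p₂) ^ 2 / (p₂ + r₂) + q) :
    p₁ < p₂ := by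
  have key : ∀ p r : ℝ, 0 < p → 0 < r →
      p = a ^ 2 * p - (a * p) ^ 2 / (p + r) + q → 1 = a ^ 2 * (r / (p + r)) + q / p := by
    intro p r hp hr h
    have hpr : p + r ≠ 0 := by positivity
    have hp0 : p ≠ 0 := hp.ne'
    have h2 : p = p * (a ^ 2 * (r / (p + r)) + q / p) := by
      calc p = a ^ 2 * p - (a * p) ^ 2 / (p + r) + q := h
        _ = p * (a ^ 2 * (r / (p + r)) + q / p) := by
          field_simp
          ring
    exact mul_left_cancel₀ hp0 (by linarith)
  have hr₂ : 0 < r₂ := hr₁.trans hr₁₂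
  have h1 := key p₁ r₁ hp₁pos hr₁ hp₁
  have h2 := key p₂ r₂ hp₂pos hr₂ hp₂
  by_contra! hle
  have hs : r₁ / (p₁ + r₁) < r₂ / (p₂ + r₂) := by
    rw [div_lt_div_iff₀ (by positivity) (by positivity)]
    nlinarith [mul_le_mul_of_nonneg_left hle hr₁.le, mul_lt_mul_of_pos_right hr₁₂ hp₁pos]
  have hqq : q / p₁ ≤ q / p₂ := div_le_div_of_nonneg_left hq.le hp₂pos hle
  have ha2 : 0 < a ^ 2 := by positivity
  have := mul_lt_mul_of_pos_left hs ha2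
  linarith
end

section
/- Let a ∈ (-1,1) with a ≠ 0, q > 0, m ≥ 2 an integer, and s¹, …, s^m > 0. Define recursively r_∞^1 = s¹, p_∞^i the unique positive solution of p = a²p − (ap)²/(p + r_∞^i) + q, α_∞^i = p_∞^i/(p_∞^i + r_∞^i), and r_∞^{i+1} = r_∞^i + s^{i+1}/(α_∞^i)². Then the limiting noise variances are strictly increasing, r_∞^1 < r_∞^2 < … < r_∞^m, and consequently the limiting prediction error variances are strictly increasing: p_∞^1 < p_∞^2 < … < p_∞^m. -/
theorem dare_mono_aux (a q p r p' r' : ℝ) (ha : a ^ 2 < 1) (ha0 : 0 < a ^ 2) (hq : 0 < q)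
    (hp : 0 < p) (hr : 0 < r) (hp' : 0 < p') (hrr : r < r')
    (h : p = a ^ 2 * p - (a * p) ^ 2 / (p + r) + q)
    (h' : p' = a ^ 2 * p' - (a * p') ^ 2 / (p' + r') + q) : p < p' := by
  have hr' : 0 < r' := hr.trans hrr
  have e : r * (a ^ 2 * p - p + q) = p * (p - q) := by
    have : p + r ≠ 0 := by positivity
    field_simp at h
    linarith
  have e' : r' * (a ^ 2 * p' - p' + q) = p' * (p' - q) := by
    have : p' + r' ≠ 0 := by positivity
    field_simp at h'
    linarith
  have hpq : q < p := by
    have h1 : (p - q) * (p + r) = a ^ 2 * p * r := by linarith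
    have h2 : 0 < (p - q) * (p + r) := by rw [h1]; positivity
    have := pos_of_mul_pos_left h2 (by positivity)
    linarith
  have hd : 0 < a ^ 2 * p - p + q := by
    have h2 : 0 < r * (a ^ 2 * p - p + q) := by
      rw [e]; exact mul_pos hp (by linarith)
    exact pos_of_mul_pos_right h2 hr.le
  by_contra! hle
  have hd' : a ^ 2 * p - p + q ≤ a ^ 2 * p' - p' + q := by nlinarith
  have h1 : r' * (a ^ 2 * p - p + q) ≤ r' * (a ^ 2 * p' - p' + q) :=
    mul_le_mul_of_nonneg_left hd' hr'.le
  have h2 : r * (a ^ 2 * p - p + q) < r' * (a ^ 2 * p - p + q) :=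
    mul_lt_mul_of_pos_right hrr hd
  have h3 : p' * (p' - q) ≤ p * (p - q) := by
    have : p' * (p' - q) ≤ p' * (p - q) := mul_le_mul_of_nonneg_left (by linarith) hp'.le
    have : p' * (p - q) ≤ p * (p - q) := mul_le_mul_of_nonneg_right hle (by linarith)
    linarith
  linarith

/-- In the private-prior setup with `m ≥ 2` agents, the limiting noise variances
`r_∞^i` and the limiting prediction error variances `p_∞^i`, defined recursively by
`r_∞^1 = s¹`, `p_∞^i` the (unique) positive solution of the DARE with noise variance
`r_∞^i`, `α_∞^i = p_∞^i/(p_∞^i + r_∞^i)`, and `r_∞^{i+1} = r_∞^i + s^{i+1}/(α_∞^i)²`,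
are strictly increasing in the agent index `i`. -/
theorem pp_limit_variances_strictMono
    (a q : ℝ) (ha : a ∈ Set.Ioo (-1 : ℝ) 1) (ha0 : a ≠ 0) (hq : 0 < q)
    (m : ℕ) (hm : 2 ≤ m) (s : ℕ → ℝ) (hs : ∀ i ∈ Finset.Icc 1 m, 0 < s i)
    (rinf pinf αinf : ℕ → ℝ)
    (hr1 : rinf 1 = s 1)
    (hp : ∀ i ∈ Finset.Icc 1 m,
      0 < pinf i ∧ pinf i = a ^ 2 * pinf i - (a * pinf i) ^ 2 / (pinf i + rinf i) + q)
    (hα : ∀ i ∈ Finset.Icc 1 m, αinf i = pinf i / (pinf i + rinf i))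
    (hrrec : ∀ i, 1 ≤ i → i + 1 ≤ m → rinf (i + 1) = rinf i + s (i + 1) / (αinf i) ^ 2) :
    (∀ i j, 1 ≤ i → i < j → j ≤ m → rinf i < rinf j) ∧
    (∀ i j, 1 ≤ i → i < j → j ≤ m → pinf i < pinf j) := by
  have hstep : ∀ i, 1 ≤ i → i + 1 ≤ m → 0 < rinf i → rinf i < rinf (i + 1) := by
    intro i h1 h2 h3
    have hi : i ∈ Finset.Icc 1 m := Finset.mem_Icc.mpr ⟨h1, by omega⟩
    have hs' := hs (i + 1) (Finset.mem_Icc.mpr ⟨by omega, h2⟩)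
    have hp' := (hp i hi).1
    have hα' : 0 < αinf i := by rw [hα i hi]; positivity
    rw [hrrec i h1 h2]
    have : 0 < s (i + 1) / (αinf i) ^ 2 := by positivity
    linarith
  have hpos : ∀ i, 1 ≤ i → i ≤ m → 0 < rinf i := by
    intro i h1
    induction i, h1 using Nat.le_induction with
    | base => intro h; rw [hr1]; exact hs 1 (Finset.mem_Icc.mpr ⟨le_rfl, h⟩)
    | succ n hn ih =>
      intro h
      have h0 := ih (by omega)
      exact h0.trans (hstep n hn h h0)
  have hR : ∀ i j, 1 ≤ i → i < j → j ≤ m → rinf i < rinf j := by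
    intro i j h1 hij
    have hij' : i + 1 ≤ j := hij
    clear hij
    induction j, hij' using Nat.le_induction with
    | base => intro h; exact hstep i h1 h (hpos i h1 (by omega))
    | succ n hn ih =>
      intro h
      exact (ih (by omega)).trans (hstep n (by omega) h (hpos n (by omega) (by omega)))
  refine ⟨hR, ?_⟩
  intro i j h1 hij hj
  have hi := hp i (Finset.mem_Icc.mpr ⟨h1, by omega⟩)
  have hj' := hp j (Finset.mem_Icc.mpr ⟨by omega, hj⟩)
  exact dare_mono_aux a q _ _ _ _ (by nlinarith [ha.1, ha.2]) (by positivity) hq hi.1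
    (hpos i h1 (by omega)) hj'.1 (hR i j h1 hij hj) hi.2 hj'.2
end

section
/- Let s¹, …, s^m > 0 with m ≥ 2, and for p > 0 define recursively f(p,1) = s¹ and, for 2 ≤ i ≤ m, f(p,i) = f(p,i−1) + γ(p,i) where γ(p,i) = s^i·(1 + f(p,i−1)/p)². Then for every i ∈ {2,…,m} there exist positive real coefficients c_0, c_1, …, c_{2^i−2} (depending only on s¹,…,s^i) such that f(p,i) = Σ_{j=0}^{2^i−2} c_j/p^j for all p > 0. -/
open Polynomial in
theorem wom_step (P : ℝ[X]) (d : ℕ) (t : ℝ) (ht : 0 < t) (hd : P.natDegree ≤ d)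
    (hP : ∀ j ≤ d, 0 < P.coeff j) :
    (P + C t * (1 + X * P) ^ 2).natDegree ≤ 2 * d + 2 ∧
    ∀ j ≤ 2 * d + 2, 0 < (P + C t * (1 + X * P) ^ 2).coeff j := by
  have hP0 : ∀ j, 0 ≤ P.coeff j := by
    intro j
    by_cases h : j ≤ d
    · exact (hP j h).le
    · rw [coeff_eq_zero_of_natDegree_lt (by omega)]
  have hXP : (X * P).natDegree ≤ d + 1 := by
    refine natDegree_mul_le.trans ?_
    have := natDegree_X_le (R := ℝ)
    omega
  have hQd : (1 + X * P).natDegree ≤ d + 1 := by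
    refine (natDegree_add_le _ _).trans ?_
    simp only [natDegree_one]
    omega
  have hQ0 : ∀ j, 0 ≤ (1 + X * P).coeff j := by
    intro j
    cases j with
    | zero => simp
    | succ j => simpa [coeff_X_mul, coeff_one] using hP0 j
  have hQ : ∀ j ≤ d + 1, 0 < (1 + X * P).coeff j := by
    intro j hj
    cases j with
    | zero => simp
    | succ j => simpa [coeff_X_mul, coeff_one] using hP j (by omega)
  constructor
  · refine (natDegree_add_le _ _).trans (max_le (by omega) ?_)
    refine (natDegree_C_mul_le _ _).trans (natDegree_pow_le.trans ?_)
    omega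
  · intro j hj
    rw [coeff_add, coeff_C_mul, sq, coeff_mul]
    refine add_pos_of_nonneg_of_pos (hP0 j) (mul_pos ht ?_)
    have hmem : (min j (d + 1), j - min j (d + 1)) ∈ Finset.HasAntidiagonal.antidiagonal j := by
      rw [Finset.HasAntidiagonal.mem_antidiagonal]
      show min j (d + 1) + (j - min j (d + 1)) = j
      omega
    have h1 := hQ (min j (d + 1)) (by omega)
    have h2 := hQ (j - min j (d + 1)) (by omega)
    exact Finset.sum_pos' (fun x _ => mul_nonneg (hQ0 _) (hQ0 _)) ⟨_, hmem, mul_pos h1 h2⟩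

/-- Lemma 2 (polynomial form): with `s¹,…,sᵐ > 0` (`m ≥ 2`), define for `p > 0`
`f(p,1) = s¹` and `f(p,i) = f(p,i−1) + s^i·(1 + f(p,i−1)/p)²` for `2 ≤ i ≤ m`.
Then for each `2 ≤ i ≤ m` there are positive coefficients `c_0,…,c_{2^i−2}` with
`f(p,i) = Σ_{j=0}^{2^i−2} c_j/p^j` for all `p > 0`. -/
theorem wom_equivalent_noise_is_positive_polynomial
    (m : ℕ) (hm : 2 ≤ m) (s : ℕ → ℝ) (hs : ∀ i ∈ Finset.Icc 1 m, 0 < s i)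
    (f : ℝ → ℕ → ℝ)
    (hf1 : ∀ p : ℝ, 0 < p → f p 1 = s 1)
    (hfrec : ∀ p : ℝ, 0 < p → ∀ i, 2 ≤ i → i ≤ m →
      f p i = f p (i - 1) + s i * (1 + f p (i - 1) / p) ^ 2) :
    ∀ i, 2 ≤ i → i ≤ m → ∃ c : ℕ → ℝ,
      (∀ j ≤ 2 ^ i - 2, 0 < c j) ∧
      ∀ p : ℝ, 0 < p → f p i = ∑ j ∈ Finset.range (2 ^ i - 1), c j / p ^ j := by
  have key : ∀ k, k + 1 ≤ m → ∃ P : Polynomial ℝ, P.natDegree ≤ 2 ^ (k + 1) - 2 ∧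
      (∀ j ≤ 2 ^ (k + 1) - 2, 0 < P.coeff j) ∧ ∀ p : ℝ, 0 < p → f p (k + 1) = P.eval p⁻¹ := by
    intro k
    induction k with
    | zero =>
      intro _
      refine ⟨Polynomial.C (s 1), by simp, ?_, ?_⟩
      · intro j hj
        have : j = 0 := by simpa using hj
        subst this
        simpa using hs 1 (by simp; omega)
      · intro p hp
        simp [hf1 p hp]
    | succ k ih =>
      intro hk
      obtain ⟨P, h1, h2, h3⟩ := ih (by omega)
      have ht : 0 < s (k + 1 + 1) := hs _ (by simp; omega)
      have hpow : 2 ^ (k + 1 + 1) - 2 = 2 * (2 ^ (k + 1) - 2) + 2 := by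
        have : 2 ^ (k + 1 + 1) = 2 * 2 ^ (k + 1) := by ring
        have : 2 ^ (k + 1) = 2 * 2 ^ k := by ring
        have : 0 < 2 ^ k := by positivity
        omega
      obtain ⟨a, b⟩ := wom_step P _ _ ht h1 h2
      rw [hpow]
      refine ⟨_, a, b, ?_⟩
      intro p hp
      rw [hfrec p hp (k + 1 + 1) (by omega) hk]
      simp only [Nat.add_sub_cancel, h3 p hp]
      simp
      left
      ring
  intro i hi him
  obtain ⟨k, rfl⟩ : ∃ k, i = k + 1 := ⟨i - 1, by omega⟩
  obtain ⟨P, h1, h2, h3⟩ := key k him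
  refine ⟨P.coeff, h2, ?_⟩
  intro p hp
  have : 2 ^ (k + 1) = 2 * 2 ^ k := by ring
  have : 0 < 2 ^ k := by positivity
  rw [h3 p hp, Polynomial.eval_eq_sum_range' (n := 2 ^ (k + 1) - 1) (by omega)]
  refine Finset.sum_congr rfl fun j _ => ?_
  rw [inv_pow, div_eq_mul_inv]
end

section
/- Let a ∈ (-1,1) with a ≠ 0 and q > 0, and define g(p) = p(q − p)/(p(1 − a²) − q). Then g is strictly increasing on the interval (q(1 − |a|)/(1 − a²), q/(1 − a²)), and g(p) → +∞ as p tends to q/(1 − a²) from the left. -/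
/-- For `a ∈ (-1,1)`, `a ≠ 0`, `q > 0`, the function
`g(p) = p(q − p)/(p(1 − a²) − q)` is strictly increasing on
`(q(1 − |a|)/(1 − a²), q/(1 − a²))` and tends to `+∞` as `p → q/(1 − a²)⁻`. -/
theorem wom_g_strictMono_and_tendsto_atTop
    (a q : ℝ) (ha : a ∈ Set.Ioo (-1 : ℝ) 1) (ha0 : a ≠ 0) (hq : 0 < q) :
    StrictMonoOn (fun p : ℝ => p * (q - p) / (p * (1 - a ^ 2) - q))
      (Set.Ioo (q * (1 - |a|) / (1 - a ^ 2)) (q / (1 - a ^ 2))) ∧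
    Filter.Tendsto (fun p : ℝ => p * (q - p) / (p * (1 - a ^ 2) - q))
      (nhdsWithin (q / (1 - a ^ 2)) (Set.Iio (q / (1 - a ^ 2)))) Filter.atTop := by
  obtain ⟨h1, h2⟩ := ha
  have hc : 0 < 1 - a ^ 2 := by nlinarith
  have ha2 : 0 < a ^ 2 := by positivity
  have hab : |a| ^ 2 = a ^ 2 := sq_abs a
  constructor
  · rintro x ⟨hx1, hx2⟩ y ⟨hy1, hy2⟩ hxy
    rw [div_lt_iff₀ hc] at hx1 hy1
    rw [lt_div_iff₀ hc] at hx2 hy2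
    have hu : 0 < q - x * (1 - a ^ 2) := by linarith
    have hv : 0 < q - y * (1 - a ^ 2) := by linarith
    have huv : (q - x * (1 - a ^ 2)) * (q - y * (1 - a ^ 2)) < (q * |a|) * (q * |a|) :=
      mul_lt_mul'' (by linarith) (by linarith) hu.le hv.le
    have e : (q * |a|) * (q * |a|) = q ^ 2 * a ^ 2 := by rw [← hab]; ring
    rw [e] at huv
    have hd : y * (q - y) / (y * (1 - a ^ 2) - q) - x * (q - x) / (x * (1 - a ^ 2) - q)
        = (y - x) * (q ^ 2 * a ^ 2 - (q - x * (1 - a ^ 2)) * (q - y * (1 - a ^ 2))) /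
          ((1 - a ^ 2) * ((q - x * (1 - a ^ 2)) * (q - y * (1 - a ^ 2)))) := by
      have n1 : y * (1 - a ^ 2) - q ≠ 0 := by linarith
      have n2 : x * (1 - a ^ 2) - q ≠ 0 := by linarith
      rw [div_sub_div _ _ n1 n2, div_eq_div_iff (mul_ne_zero n1 n2) (by positivity)]
      ring
    have hp : 0 < (y - x) * (q ^ 2 * a ^ 2 - (q - x * (1 - a ^ 2)) * (q - y * (1 - a ^ 2))) /
          ((1 - a ^ 2) * ((q - x * (1 - a ^ 2)) * (q - y * (1 - a ^ 2)))) :=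
      div_pos (mul_pos (by linarith) (by linarith)) (by positivity)
    rw [← hd] at hp
    exact sub_pos.mp hp
  · have hneg : q / (1 - a ^ 2) * (q - q / (1 - a ^ 2)) < 0 := by
      apply mul_neg_of_pos_of_neg (by positivity)
      rw [sub_neg, lt_div_iff₀ hc]
      nlinarith
    have hnum : Filter.Tendsto (fun p : ℝ => p * (q - p))
        (nhdsWithin (q / (1 - a ^ 2)) (Set.Iio (q / (1 - a ^ 2))))
        (nhds (q / (1 - a ^ 2) * (q - q / (1 - a ^ 2)))) :=
      (Continuous.tendsto (by fun_prop) _).mono_left nhdsWithin_le_nhds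
    have hden : Filter.Tendsto (fun p : ℝ => p * (1 - a ^ 2) - q)
        (nhdsWithin (q / (1 - a ^ 2)) (Set.Iio (q / (1 - a ^ 2))))
        (nhdsWithin 0 (Set.Iio 0)) := by
      apply tendsto_nhdsWithin_of_tendsto_nhds_of_eventually_within
      · have h : Filter.Tendsto (fun p : ℝ => p * (1 - a ^ 2) - q) (nhds (q / (1 - a ^ 2)))
            (nhds (q / (1 - a ^ 2) * (1 - a ^ 2) - q)) :=
          Continuous.tendsto (by fun_prop) _
        rw [div_mul_cancel₀ _ hc.ne', sub_self] at h
        exact h.mono_left nhdsWithin_le_nhds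
      · filter_upwards [self_mem_nhdsWithin] with p hp
        have hp' := (lt_div_iff₀ hc).mp (Set.mem_Iio.mp hp)
        exact sub_neg.mpr hp'
    simp only [div_eq_mul_inv _ (_ * (1 - a ^ 2) - q)]
    exact hnum.neg_mul_atBot hneg (tendsto_inv_nhdsLT_zero.comp hden)
end

section
/- Let a ∈ (-1,1) with a ≠ 0, q > 0, and let f : (0, ∞) → (0, ∞) be continuous and strictly decreasing. Then the map T(p) = a²·p·f(p)/(p + f(p)) + q has exactly one fixed point p_∞ in (0, ∞), and this fixed point satisfies q < p_∞ < q/(1 − a²). -/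
/-- Theorem 2 (abstract form): for `a ∈ (-1,1)`, `a ≠ 0`, `q > 0`, and `f`
continuous, positive and strictly decreasing on `(0,∞)`, the WoM Riccati map
`T(p) = a²·p·f(p)/(p + f(p)) + q` has exactly one fixed point in `(0,∞)`, and every
positive fixed point lies in `(q, q/(1 − a²))`. -/
theorem wom_map_existsUnique_fixed_point
    (a q : ℝ) (ha : a ∈ Set.Ioo (-1 : ℝ) 1) (ha0 : a ≠ 0) (hq : 0 < q)
    (f : ℝ → ℝ) (hfpos : ∀ p : ℝ, 0 < p → 0 < f p)
    (hfcont : ContinuousOn f (Set.Ioi (0 : ℝ)))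
    (hfanti : StrictAntiOn f (Set.Ioi (0 : ℝ))) :
    (∃! p : ℝ, 0 < p ∧ a ^ 2 * (p * f p / (p + f p)) + q = p) ∧
    (∀ p : ℝ, 0 < p → a ^ 2 * (p * f p / (p + f p)) + q = p →
      q < p ∧ p < q / (1 - a ^ 2)) := by
  have ha2 : 0 < a ^ 2 := by positivity
  have ha1 : 0 < 1 - a ^ 2 := by nlinarith [ha.1, ha.2]
  have hpos : ∀ p : ℝ, 0 < p → 0 < p * f p / (p + f p) := by
    intro p hp
    have := hfpos p hp
    positivity
  have hlt : ∀ p : ℝ, 0 < p → p * f p / (p + f p) < p := by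
    intro p hp
    have := hfpos p hp
    rw [div_lt_iff₀ (by positivity)]
    nlinarith [mul_pos hp hp]
  have hb : ∀ p : ℝ, 0 < p → a ^ 2 * (p * f p / (p + f p)) + q = p →
      q < p ∧ p < q / (1 - a ^ 2) := by
    intro p hp h
    have h1 := mul_pos ha2 (hpos p hp)
    have h2 := mul_lt_mul_of_pos_left (hlt p hp) ha2
    refine ⟨by linarith, ?_⟩
    rw [lt_div_iff₀ ha1]
    linarith
  have huniq : ∀ x y : ℝ, 0 < x → a ^ 2 * (x * f x / (x + f x)) + q = x →
      a ^ 2 * (y * f y / (y + f y)) + q = y → x < y → False := by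
    intro x y hx ex ey hxy
    have hy : 0 < y := hx.trans hxy
    have fx := hfpos x hx
    have fy := hfpos y hy
    have hf : f y < f x := hfanti hx hy hxy
    have hg : f y / (y + f y) < f x / (x + f x) := by
      rw [div_lt_div_iff₀ (by positivity) (by positivity)]
      nlinarith [mul_lt_mul hf hxy.le hx fx.le]
    have hg1 : f x / (x + f x) < 1 := by
      rw [div_lt_one (by positivity)]
      linarith
    rw [mul_div_assoc] at ex ey
    generalize f x / (x + f x) = u at *
    generalize f y / (y + f y) = v at *
    have h1 : a ^ 2 * v < a ^ 2 * u := mul_lt_mul_of_pos_left hg ha2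
    have h2 : a ^ 2 * u < a ^ 2 * 1 := mul_lt_mul_of_pos_left hg1 ha2
    have h3 : 0 < (y - x) * (1 - a ^ 2 * u) := mul_pos (by linarith) (by linarith)
    have h4 : 0 < y * (a ^ 2 * u - a ^ 2 * v) := mul_pos hy (by linarith)
    nlinarith
  refine ⟨?_, hb⟩
  have hqb : q ≤ q / (1 - a ^ 2) := by
    rw [le_div_iff₀ ha1]
    nlinarith
  have hcont : ContinuousOn (fun p => a ^ 2 * (p * f p / (p + f p)) + q - p)
      (Set.Icc q (q / (1 - a ^ 2))) := by
    have hc : ContinuousOn f (Set.Icc q (q / (1 - a ^ 2))) :=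
      hfcont.mono fun x hx => lt_of_lt_of_le hq hx.1
    have hne : ∀ x ∈ Set.Icc q (q / (1 - a ^ 2)), x + f x ≠ 0 := by
      intro x hx
      have hx0 : 0 < x := lt_of_lt_of_le hq hx.1
      have := hfpos x hx0
      positivity
    exact ((continuousOn_const.mul ((continuousOn_id.mul hc).div
      (continuousOn_id.add hc) hne)).add continuousOn_const).sub continuousOn_id
  have hmem : (0 : ℝ) ∈ (fun p => a ^ 2 * (p * f p / (p + f p)) + q - p) ''
      (Set.Icc q (q / (1 - a ^ 2))) := by
    apply intermediate_value_Icc' hqb hcont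
    constructor
    · have h2 := mul_lt_mul_of_pos_left (hlt (q / (1 - a ^ 2)) (by positivity)) ha2
      have h3 : q / (1 - a ^ 2) * (1 - a ^ 2) = q := div_mul_cancel₀ _ ha1.ne'
      linarith
    · have := mul_pos ha2 (hpos q hq)
      linarith
  obtain ⟨p, hp, hpe⟩ := hmem
  have hp0 : 0 < p := lt_of_lt_of_le hq hp.1
  have hpe' : a ^ 2 * (p * f p / (p + f p)) + q = p := sub_eq_zero.mp hpe
  refine ⟨p, ⟨hp0, hpe'⟩, ?_⟩
  rintro y ⟨hy, ey⟩
  rcases lt_trichotomy y p with h | h | h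
  · exact (huniq y p hy ey hpe' h).elim
  · exact h
  · exact (huniq p y hp0 hpe' ey h).elim
end

section
/- Let a ∈ (-1,1) with a ≠ 0, q > 0, m ≥ 2 an integer, and s¹, …, s^m > 0. Define f(p) = f(p,m) by the recursion f(p,1) = s¹, f(p,i) = f(p,i−1) + s^i·(1 + f(p,i−1)/p)² for p > 0. Then the Word-of-Mouth Riccati map T(p) = a²·p·f(p)/(p + f(p)) + q has a unique positive fixed point p_∞, and q < p_∞ < q/(1 − a²). -/
/-- Theorem 2: for `a ∈ (-1,1)`, `a ≠ 0`, `q > 0`, `m ≥ 2` and `s¹,…,sᵐ > 0`,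
with `f(p) = f(p,m)` defined by `f(p,1) = s¹`,
`f(p,i) = f(p,i−1) + s^i·(1 + f(p,i−1)/p)²`, the WoM Riccati map
`T(p) = a²·p·f(p)/(p + f(p)) + q` has a unique positive fixed point `p_∞`, and
`q < p_∞ < q/(1 − a²)`. -/
theorem wom_riccati_map_unique_fixed_point
    (a q : ℝ) (ha : a ∈ Set.Ioo (-1 : ℝ) 1) (ha0 : a ≠ 0) (hq : 0 < q)
    (m : ℕ) (hm : 2 ≤ m) (s : ℕ → ℝ) (hs : ∀ i ∈ Finset.Icc 1 m, 0 < s i)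
    (f : ℝ → ℕ → ℝ)
    (hf1 : ∀ p : ℝ, 0 < p → f p 1 = s 1)
    (hfrec : ∀ p : ℝ, 0 < p → ∀ i, 2 ≤ i → i ≤ m →
      f p i = f p (i - 1) + s i * (1 + f p (i - 1) / p) ^ 2) :
    (∃! pinf : ℝ, 0 < pinf ∧
      a ^ 2 * (pinf * f pinf m / (pinf + f pinf m)) + q = pinf) ∧
    (∀ pinf : ℝ, 0 < pinf →
      a ^ 2 * (pinf * f pinf m / (pinf + f pinf m)) + q = pinf →
      q < pinf ∧ pinf < q / (1 - a ^ 2)) := by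
  obtain ⟨ha1, ha2⟩ := ha
  have hA : 0 < a ^ 2 := by positivity
  have hA1 : a ^ 2 < 1 := by nlinarith
  have key : ∀ n : ℕ, n + 1 ≤ m → (∀ p, 0 < p → 0 < f p (n + 1)) ∧
      (∀ p r, 0 < p → p ≤ r → f r (n + 1) ≤ f p (n + 1)) ∧
      ContinuousOn (fun p => f p (n + 1)) (Set.Ioi 0) := by
    intro n
    induction n with
    | zero =>
      intro h
      refine ⟨fun p hp => ?_, fun p r hp hr => ?_, ?_⟩
      · rw [hf1 p hp]
        exact hs 1 (by simp; omega)
      · rw [zero_add, hf1 p hp, hf1 r (by linarith)]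
      · exact (continuousOn_const (c := s 1)).congr (fun p hp => hf1 p hp)
    | succ k ih =>
      intro h
      obtain ⟨h1, h2, h3⟩ := ih (by omega)
      have hsk : 0 < s (k + 1 + 1) := hs _ (by simp; omega)
      have e : ∀ p, 0 < p → f p (k + 1 + 1) =
          f p (k + 1) + s (k + 1 + 1) * (1 + f p (k + 1) / p) ^ 2 := by
        intro p hp
        simpa using hfrec p hp (k + 1 + 1) (by omega) h
      refine ⟨fun p hp => ?_, fun p r hp hr => ?_, ?_⟩
      · rw [e p hp]
        have := h1 p hp
        positivity
      · have hr0 : 0 < r := by linarith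
        rw [e p hp, e r hr0]
        have a1 := h1 p hp
        have a2 := h1 r hr0
        have a3 := h2 p r hp hr
        have a4 : f r (k + 1) / r ≤ f p (k + 1) / p := by gcongr
        gcongr
      · refine ContinuousOn.congr (f := fun p => f p (k + 1) + s (k + 1 + 1) * (1 + f p (k + 1) / p) ^ 2) ?_ (fun p hp => e p hp)
        exact h3.add (continuousOn_const.mul ((continuousOn_const.add
          (h3.div continuousOn_id (fun p hp => ne_of_gt hp))).pow 2))
  obtain ⟨k, rfl⟩ : ∃ k, m = k + 1 := ⟨m - 1, by omega⟩
  obtain ⟨h1, h2, h3⟩ := key k le_rfl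
  have hb : ∀ p, 0 < p → 0 < p * f p (k + 1) / (p + f p (k + 1)) ∧
      p * f p (k + 1) / (p + f p (k + 1)) < p := by
    intro p hp
    have := h1 p hp
    refine ⟨by positivity, ?_⟩
    rw [div_lt_iff₀ (by positivity)]
    nlinarith
  have huniq : ∀ p r, 0 < p → p < r →
      a ^ 2 * (p * f p (k + 1) / (p + f p (k + 1))) + q = p →
      a ^ 2 * (r * f r (k + 1) / (r + f r (k + 1))) + q = r → False := by
    intro p r hp hpr ep er
    have hr : 0 < r := by linarith
    have a1 := h1 p hp
    have a2 := h1 r hr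
    have a3 := h2 p r hp hpr.le
    have a4 : f r (k + 1) / (r + f r (k + 1)) ≤ f p (k + 1) / (p + f p (k + 1)) := by
      rw [div_le_div_iff₀ (by positivity) (by positivity)]
      nlinarith [mul_le_mul a3 hpr.le hp.le a1.le]
    rw [mul_div_assoc] at ep er
    set x := f p (k + 1) / (p + f p (k + 1))
    set y := f r (k + 1) / (r + f r (k + 1))
    have b1 : q = p * (1 - a ^ 2 * x) := by linarith
    have b2 : q = r * (1 - a ^ 2 * y) := by linarith
    have b3 : 0 < 1 - a ^ 2 * x := by
      by_contra hc
      push Not at hc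
      nlinarith
    have b4 : a ^ 2 * y ≤ a ^ 2 * x := by gcongr
    nlinarith
  have hc : ContinuousOn (fun p => a ^ 2 * (p * f p (k + 1) / (p + f p (k + 1))) + q - p)
      (Set.Ioi 0) := by
    refine ((continuousOn_const.mul ((continuousOn_id.mul h3).div
      (continuousOn_id.add h3) ?_)).add continuousOn_const).sub continuousOn_id
    intro p hp
    exact ne_of_gt (add_pos hp (h1 p hp))
  have hd : 0 < 1 - a ^ 2 := by linarith
  constructor
  · set R := q / (1 - a ^ 2) with hR
    have hRe : R * (1 - a ^ 2) = q := div_mul_cancel₀ _ hd.ne'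
    have hR0 : 0 < R := by positivity
    have hqR : q ≤ R := by nlinarith
    have hiv := intermediate_value_Icc' hqR (hc.mono (fun x hx => lt_of_lt_of_le hq hx.1))
    have hz : (0 : ℝ) ∈ Set.Icc (a ^ 2 * (R * f R (k + 1) / (R + f R (k + 1))) + q - R)
        (a ^ 2 * (q * f q (k + 1) / (q + f q (k + 1))) + q - q) := by
      constructor
      · have := (hb R hR0).2
        nlinarith
      · have := (hb q hq).1
        nlinarith
    obtain ⟨p, hp, e⟩ := hiv hz
    have hp0 : 0 < p := lt_of_lt_of_le hq hp.1
    have e' : a ^ 2 * (p * f p (k + 1) / (p + f p (k + 1))) + q = p := sub_eq_zero.mp e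
    refine ⟨p, ⟨hp0, e'⟩, ?_⟩
    rintro r ⟨hr, er⟩
    rcases lt_trichotomy r p with h | h | h
    · exact (huniq r p hr h er e').elim
    · exact h
    · exact (huniq p r hp0 h e' er).elim
  · intro p hp e
    obtain ⟨b1, b2⟩ := hb p hp
    constructor
    · nlinarith
    · rw [lt_div_iff₀ hd]
      nlinarith
end

section
/- Let a ∈ (-1,1), q > 0, and let f : (0, ∞) → (0, ∞) be non-increasing. Define T(p) = a²·p·f(p)/(p + f(p)) + q. Then for all p' ≥ p'' > 0, T(p') − T(p'') ≤ a²·(p' − p''). -/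
/-- For `a ∈ (-1,1)`, `q > 0`, and a non-increasing positive function `f` on `(0,∞)`,
the WoM Riccati map `T(p) = a²·p·f(p)/(p + f(p)) + q` satisfies the one-sided bound
`T(p') − T(p'') ≤ a²·(p' − p'')` for all `p' ≥ p'' > 0`. -/
theorem wom_map_upper_increment_bound
    (a q : ℝ) (ha : a ∈ Set.Ioo (-1 : ℝ) 1) (hq : 0 < q)
    (f : ℝ → ℝ) (hfpos : ∀ p : ℝ, 0 < p → 0 < f p)
    (hfanti : AntitoneOn f (Set.Ioi (0 : ℝ))) :
    ∀ p' p'' : ℝ, 0 < p'' → p'' ≤ p' →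
      (a ^ 2 * (p' * f p' / (p' + f p')) + q) -
        (a ^ 2 * (p'' * f p'' / (p'' + f p'')) + q) ≤ a ^ 2 * (p' - p'') := by
  intro x y hy hyx
  have hx : 0 < x := lt_of_lt_of_le hy hyx
  have hu := hfpos x hx
  have hv := hfpos y hy
  have huv : f x ≤ f y := hfanti hy hx hyx
  have e1 : x * f x / (x + f x) = x - x ^ 2 / (x + f x) := by
    have : x + f x ≠ 0 := by positivity
    field_simp
    ring
  have e2 : y * f y / (y + f y) = y - y ^ 2 / (y + f y) := by
    have : y + f y ≠ 0 := by positivity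
    field_simp
    ring
  have key : y ^ 2 / (y + f y) ≤ x ^ 2 / (x + f x) := by
    rw [div_le_div_iff₀ (by positivity) (by positivity)]
    have h1 : y ^ 2 ≤ x ^ 2 := by gcongr
    have h2 : y ^ 2 * f x ≤ x ^ 2 * f y := by gcongr
    have h3 : 0 ≤ x * y * (x - y) :=
      mul_nonneg (by positivity) (by linarith)
    nlinarith
  have := mul_le_mul_of_nonneg_left key (sq_nonneg a)
  rw [e1, e2]
  linarith
end

section
/- Let a ∈ (-1,1), q > 0, and let c₀, c₁, c₂ > 0 be real. Define f(p) = c₀ + c₁/p + c₂/p² and T(p) = a²·p·f(p)/(p + f(p)) + q for p > 0. Then T satisfies the Lipschitz bound |T(p') − T(p'')| ≤ a²·|p' − p''| for all p', p'' > 0; that is, T is a contraction on (0, ∞) with Lipschitz constant a² < 1. -/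
/-- For `a ∈ (-1,1)`, `q > 0`, and `f(p) = c₀ + c₁/p + c₂/p²` with positive
coefficients, the WoM Riccati map `T(p) = a²·p·f(p)/(p + f(p)) + q` is a contraction
on `(0,∞)` with Lipschitz constant `a² < 1`:
`|T(p') − T(p'')| ≤ a²·|p' − p''|` for all `p', p'' > 0`. -/
theorem wom_map_contraction_two_agents
    (a q : ℝ) (ha : a ∈ Set.Ioo (-1 : ℝ) 1) (hq : 0 < q)
    (c₀ c₁ c₂ : ℝ) (hc₀ : 0 < c₀) (hc₁ : 0 < c₁) (hc₂ : 0 < c₂) :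
    ∀ p' p'' : ℝ, 0 < p' → 0 < p'' →
      |(a ^ 2 * (p' * (c₀ + c₁ / p' + c₂ / p' ^ 2) /
          (p' + (c₀ + c₁ / p' + c₂ / p' ^ 2))) + q) -
        (a ^ 2 * (p'' * (c₀ + c₁ / p'' + c₂ / p'' ^ 2) /
          (p'' + (c₀ + c₁ / p'' + c₂ / p'' ^ 2))) + q)| ≤ a ^ 2 * |p' - p''| := by
  intro x y hx hy
  have e : ∀ p : ℝ, 0 < p → p * (c₀ + c₁ / p + c₂ / p ^ 2) /
      (p + (c₀ + c₁ / p + c₂ / p ^ 2)) = p - p ^ 4 / (p ^ 3 + (c₀ * p ^ 2 + c₁ * p + c₂)) := by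
    intro p hp
    have h1 : 0 < p ^ 3 + (c₀ * p ^ 2 + c₁ * p + c₂) := by positivity
    have h2 : c₀ + c₁ / p + c₂ / p ^ 2 = (c₀ * p ^ 2 + c₁ * p + c₂) / p ^ 2 := by
      field_simp
    have h3 : p + (c₀ + c₁ / p + c₂ / p ^ 2)
        = (p ^ 3 + (c₀ * p ^ 2 + c₁ * p + c₂)) / p ^ 2 := by
      field_simp
    rw [h3, h2]
    field_simp
    ring
  rw [e x hx, e y hy]
  obtain ⟨D, hD⟩ : ∃ D, D = x ^ 3 + (c₀ * x ^ 2 + c₁ * x + c₂) := ⟨_, rfl⟩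
  obtain ⟨E, hE⟩ : ∃ E, E = y ^ 3 + (c₀ * y ^ 2 + c₁ * y + c₂) := ⟨_, rfl⟩
  obtain ⟨K, hK⟩ : ∃ K, K = x ^ 3 * y ^ 3 + c₀ * (x ^ 2 * y ^ 2 * (x + y))
    + c₁ * (x * y * (x ^ 2 + x * y + y ^ 2)) + c₂ * ((x + y) * (x ^ 2 + y ^ 2)) := ⟨_, rfl⟩
  have hD0 : 0 < D := by rw [hD]; positivity
  have hE0 : 0 < E := by rw [hE]; positivity
  have hK0 : 0 < K := by rw [hK]; positivity
  have hKle : K ≤ 2 * (D * E) := by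
    have k1 : 0 ≤ c₁ * (x * y * (x ^ 2 - x * y + y ^ 2)) := by
      have : 0 ≤ x ^ 2 - x * y + y ^ 2 := by nlinarith [sq_nonneg (x - y)]
      positivity
    have k2 : 0 ≤ c₂ * ((x + y) * (x - y) ^ 2) := by positivity
    have k3 : 0 ≤ x ^ 3 * y ^ 3 + c₀ * (x ^ 2 * y ^ 2 * (x + y))
      + 2 * ((c₀ * x ^ 2 + c₁ * x + c₂) * (c₀ * y ^ 2 + c₁ * y + c₂)) := by positivity
    rw [hK, hD, hE]
    nlinarith [k1, k2, k3]
  have key : (a ^ 2 * (x - x ^ 4 / D) + q) - (a ^ 2 * (y - y ^ 4 / E) + q)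
      = a ^ 2 * ((x - y) * (1 - K / (D * E))) := by
    have : x ^ 4 / D - y ^ 4 / E = (x - y) * (K / (D * E)) := by
      have h : x ^ 4 * E - D * y ^ 4 = (x - y) * K := by
        rw [hK, hD, hE]; ring
      rw [div_sub_div _ _ hD0.ne' hE0.ne', h, mul_div_assoc]
    linear_combination (-a ^ 2) * this
  rw [← hD, ← hE, key, abs_mul, abs_mul, abs_of_nonneg (sq_nonneg a)]
  have hb : |1 - K / (D * E)| ≤ 1 := by
    have h1 : 0 ≤ K / (D * E) := by positivity
    have h2 : K / (D * E) ≤ 2 := by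
      rw [div_le_iff₀ (by positivity)]; exact hKle
    rw [abs_le]; constructor <;> linarith
  exact mul_le_mul_of_nonneg_left (mul_le_of_le_one_right (abs_nonneg _) hb) (sq_nonneg a)
end

section
/- Let a ∈ (-1,1), q > 0, and let c₀, c₁, c₂ > 0 be real. Define f(p) = c₀ + c₁/p + c₂/p² and T(p) = a²·p·f(p)/(p + f(p)) + q for p > 0. Then T has a unique positive fixed point p_∞, and for every initial value p₁ > 0 the sequence defined by p_{k+1} = T(p_k) converges to p_∞ as k → ∞. -/
theorem wom_aux (c₀ c₁ c₂ x y : ℝ) (hc₀ : 0 < c₀) (hc₁ : 0 < c₁) (hc₂ : 0 < c₂)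
    (hx : 0 < x) (hxy : x ≤ y) :
    |x * (c₀ * x ^ 2 + c₁ * x + c₂) / (x ^ 3 + (c₀ * x ^ 2 + c₁ * x + c₂))
      - y * (c₀ * y ^ 2 + c₁ * y + c₂) / (y ^ 3 + (c₀ * y ^ 2 + c₁ * y + c₂))| ≤ y - x := by
  have hy : 0 < y := lt_of_lt_of_le hx hxy
  obtain ⟨d, hd, rfl⟩ : ∃ d, 0 ≤ d ∧ y = x + d := ⟨y - x, by linarith, by ring⟩
  have h1 : 0 < x ^ 3 + (c₀ * x ^ 2 + c₁ * x + c₂) := by positivity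
  have h2 : 0 < (x + d) ^ 3 + (c₀ * (x + d) ^ 2 + c₁ * (x + d) + c₂) := by positivity
  rw [div_sub_div _ _ h1.ne' h2.ne', abs_le]
  constructor
  · rw [le_div_iff₀ (by positivity), ← sub_nonneg]
    ring_nf
    positivity
  · rw [div_le_iff₀ (by positivity), ← sub_nonneg]
    have e : 0 ≤ d * (x ^ 3 * (x + d) ^ 3 + c₀ * (x ^ 2 * (x + d) ^ 2 * (2 * x + d))
      + c₁ * (x * (x + d) * (x ^ 2 + x * d + d ^ 2)) + c₂ * ((2 * x + d) * d ^ 2)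
      + 2 * (c₀ * x ^ 2 + c₁ * x + c₂) * (c₀ * (x + d) ^ 2 + c₁ * (x + d) + c₂)) := by positivity
    refine e.trans (le_of_eq ?_)
    ring

/-- Theorem 3 (two-agent WoM): for `a ∈ (-1,1)`, `q > 0`, and
`f(p) = c₀ + c₁/p + c₂/p²` with positive coefficients, the WoM Riccati map
`T(p) = a²·p·f(p)/(p + f(p)) + q` has a unique positive fixed point `p_∞`, and every
iteration `p_{k+1} = T(p_k)` started from any `p₁ > 0` converges to `p_∞`. -/
theorem wom_two_agent_convergence
    (a q : ℝ) (ha : a ∈ Set.Ioo (-1 : ℝ) 1) (hq : 0 < q)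
    (c₀ c₁ c₂ : ℝ) (hc₀ : 0 < c₀) (hc₁ : 0 < c₁) (hc₂ : 0 < c₂)
    (T : ℝ → ℝ)
    (hT : ∀ p : ℝ, 0 < p →
      T p = a ^ 2 * (p * (c₀ + c₁ / p + c₂ / p ^ 2) /
        (p + (c₀ + c₁ / p + c₂ / p ^ 2))) + q) :
    ∃ pinf : ℝ, 0 < pinf ∧ T pinf = pinf ∧
      (∀ p : ℝ, 0 < p → T p = p → p = pinf) ∧
      (∀ p : ℕ → ℝ, 0 < p 1 → (∀ k ≥ 1, p (k + 1) = T (p k)) →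
        Filter.Tendsto p Filter.atTop (nhds pinf)) := by
  have hform : ∀ p : ℝ, 0 < p → T p = a ^ 2 * (p * (c₀ * p ^ 2 + c₁ * p + c₂) /
      (p ^ 3 + (c₀ * p ^ 2 + c₁ * p + c₂))) + q := by
    intro p hp
    rw [hT p hp]
    congr 2
    have h1 : 0 < p ^ 3 + (c₀ * p ^ 2 + c₁ * p + c₂) := by positivity
    have h2 : 0 < p + (c₀ + c₁ / p + c₂ / p ^ 2) := by positivity
    rw [div_eq_div_iff h2.ne' h1.ne']
    field_simp
  have hTq : ∀ p : ℝ, 0 < p → q ≤ T p := by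
    intro p hp
    rw [hform p hp]
    have : 0 ≤ a ^ 2 * (p * (c₀ * p ^ 2 + c₁ * p + c₂) /
      (p ^ 3 + (c₀ * p ^ 2 + c₁ * p + c₂))) := by positivity
    linarith
  have ha1 : a ^ 2 < 1 := by
    rw [sq_lt_one_iff_abs_lt_one, abs_lt]
    exact ha
  have hl : ∀ x y : ℝ, 0 < x → x ≤ y → |T x - T y| ≤ a ^ 2 * |x - y| := by
    intro x y hx hxy
    have h := wom_aux c₀ c₁ c₂ x y hc₀ hc₁ hc₂ hx hxy
    rw [hform x hx, hform y (hx.trans_le hxy), add_sub_add_right_eq_sub, ← mul_sub, abs_mul,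
      abs_of_nonneg (sq_nonneg a), abs_sub_comm x y, abs_of_nonneg (sub_nonneg.2 hxy)]
    exact mul_le_mul_of_nonneg_left h (sq_nonneg a)
  have hlip : ∀ x y : ℝ, 0 < x → 0 < y → |T x - T y| ≤ a ^ 2 * |x - y| := by
    intro x y hx hy
    rcases le_total x y with h | h
    · exact hl x y hx h
    · rw [abs_sub_comm (T x), abs_sub_comm x]
      exact hl y x hy h
  have hS : ContractingWith (⟨a ^ 2, sq_nonneg a⟩ : NNReal) (fun x => T (max x q)) := by
    refine ⟨by exact_mod_cast ha1, LipschitzWith.of_dist_le_mul fun x y => ?_⟩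
    rw [Real.dist_eq, Real.dist_eq]
    refine (hlip _ _ (lt_max_of_lt_right hq) (lt_max_of_lt_right hq)).trans ?_
    exact mul_le_mul_of_nonneg_left (abs_max_sub_max_le_abs x y q) (sq_nonneg a)
  have hfix : T (max (ContractingWith.fixedPoint _ hS) q) = ContractingWith.fixedPoint _ hS :=
    hS.fixedPoint_isFixedPt
  generalize ContractingWith.fixedPoint _ hS = r at hfix
  have hr : q ≤ r := hfix ▸ hTq _ (lt_max_of_lt_right hq)
  rw [max_eq_left hr] at hfix
  have hr0 : 0 < r := hq.trans_le hr
  refine ⟨r, hr0, hfix, ?_, ?_⟩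
  · intro p hp hpT
    have h := hlip p r hp hr0
    rw [hpT, hfix] at h
    by_contra hne
    have : 0 < |p - r| := abs_pos.2 (sub_ne_zero.2 hne)
    nlinarith
  · intro p hp1 hp
    have hpos : ∀ k, 0 < p (k + 1) := by
      intro k
      induction k with
      | zero => exact hp1
      | succ k ih =>
        rw [hp (k + 1) (by omega)]
        exact hq.trans_le (hTq _ ih)
    have hb : ∀ k, |p (k + 1) - r| ≤ (a ^ 2) ^ k * |p 1 - r| := by
      intro k
      induction k with
      | zero => simp
      | succ k ih =>
        have h := hlip _ r (hpos k) hr0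
        rw [hfix, ← hp (k + 1) (by omega)] at h
        refine h.trans ?_
        rw [pow_succ' (a ^ 2) k, mul_assoc]
        exact mul_le_mul_of_nonneg_left ih (sq_nonneg a)
    rw [← Filter.tendsto_add_atTop_iff_nat 1, tendsto_iff_dist_tendsto_zero]
    refine squeeze_zero (fun _ => dist_nonneg) hb ?_
    simpa using (tendsto_pow_atTop_nhds_zero_of_lt_one (sq_nonneg a) ha1).mul_const |p 1 - r|
end
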